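/- Layer-splitting lemma (two-user case): For any product input pmf p = p(x)p(w) for the channel p(y₁|x,w), the region 𝓡₁,SD(p) equals the union, over all split distributions p' ≃ p, of 𝓡_RS(p'). That is, 𝓡₁,SD(p) = ⋃_{p' ≃ p} 𝓡_RS(p'). -/

import Mathlib

open scoped BigOperators Classical

noncomputable section

/-- Pushforward of a finitely supported weight function along a map. -/
def pushf {Ω β : Type*} [Fintype Ω] (q : Ω → ℝ) (f : Ω → β) : β → ℝ :=
  fun b => ∑ ω, if f ω = b then q ω else 0

/-- Shannon entropy (in nats). -/
def ent {β : Type*} [Fintype β] (p : β → ℝ) : ℝ :=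
  -∑ b, p b * Real.log (p b)

/-- Entropy of the random variable `A` under the joint pmf `q`. -/
def Hof {Ω β : Type*} [Fintype Ω] [Fintype β] (q : Ω → ℝ) (A : Ω → β) : ℝ :=
  ent (pushf q A)

/-- Mutual information `I(A;B)` under the joint pmf `q`. -/
def miOf {Ω α β : Type*} [Fintype Ω] [Fintype α] [Fintype β]
    (q : Ω → ℝ) (A : Ω → α) (B : Ω → β) : ℝ :=
  Hof q A + Hof q B - Hof q (fun ω => (A ω, B ω))

/-- Conditional mutual information `I(A;B|C)` under the joint pmf `q`. -/
def cmiOf {Ω α β γ : Type*} [Fintype Ω] [Fintype α] [Fintype β] [Fintype γ]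
    (q : Ω → ℝ) (A : Ω → α) (B : Ω → β) (C : Ω → γ) : ℝ :=
  Hof q (fun ω => (A ω, C ω)) + Hof q (fun ω => (B ω, C ω))
    - Hof q (fun ω => (A ω, B ω, C ω)) - Hof q C

/-- `p` is a probability mass function. -/
def IsPMF {α : Type*} [Fintype α] (p : α → ℝ) : Prop :=
  (∀ a, 0 ≤ p a) ∧ ∑ a, p a = 1

/-- Joint pmf on `(X, W, Y₁, Y₂)` induced by the product input pmf `pX · pW`
and the interference channel `ch`. -/
def icJoint {𝒳 𝒲 𝒴₁ 𝒴₂ : Type} (pX : 𝒳 → ℝ) (pW : 𝒲 → ℝ)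
    (ch : 𝒳 → 𝒲 → 𝒴₁ → 𝒴₂ → ℝ) : 𝒳 × 𝒲 × 𝒴₁ × 𝒴₂ → ℝ :=
  fun ω => pX ω.1 * pW ω.2.1 * ch ω.1 ω.2.1 ω.2.2.1 ω.2.2.2

/-- The simultaneous-decoding region `𝓡₁,SD(p)` at receiver 1:
`R₁ ≤ I(X;Y₁|W)`, `R₂ ≤ I(W;Y₁|X)`, `R₁+R₂ ≤ I(X,W;Y₁)`. -/
def R1SD {𝒳 𝒲 𝒴₁ 𝒴₂ : Type} [Fintype 𝒳] [Fintype 𝒲] [Fintype 𝒴₁] [Fintype 𝒴₂]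
    (pX : 𝒳 → ℝ) (pW : 𝒲 → ℝ) (ch : 𝒳 → 𝒲 → 𝒴₁ → 𝒴₂ → ℝ) : Set (ℝ × ℝ) :=
  {R | 0 ≤ R.1 ∧ 0 ≤ R.2 ∧
    R.1 ≤ cmiOf (icJoint pX pW ch) (fun ω => ω.1) (fun ω => ω.2.2.1) (fun ω => ω.2.1) ∧
    R.2 ≤ cmiOf (icJoint pX pW ch) (fun ω => ω.2.1) (fun ω => ω.2.2.1) (fun ω => ω.1) ∧
    R.1 + R.2 ≤ miOf (icJoint pX pW ch) (fun ω => (ω.1, ω.2.1)) (fun ω => ω.2.2.1)}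

/-- A two-layer split distribution `p'` for sender 1, together with sender 2's pmf:
independent `X₁ ~ p1`, `X₂ ~ p2`, `W ~ pw` and a symbol-by-symbol map `f`. -/
structure SplitDist2 (𝒳 𝒲 : Type) [Fintype 𝒳] [Fintype 𝒲] where
  A1 : Type
  A2 : Type
  [fin1 : Fintype A1]
  [fin2 : Fintype A2]
  p1 : A1 → ℝ
  p2 : A2 → ℝ
  pw : 𝒲 → ℝ
  f : A1 → A2 → 𝒳
  p1_pmf : IsPMF p1
  p2_pmf : IsPMF p2
  pw_pmf : IsPMF pw

attribute [instance] SplitDist2.fin1 SplitDist2.fin2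

/-- `p' ≃ p` : the split distribution induces `X = f(X₁,X₂) ~ pX` and `W ~ pW`. -/
def SplitDist2.Matches {𝒳 𝒲 : Type} [Fintype 𝒳] [Fintype 𝒲]
    (s : SplitDist2 𝒳 𝒲) (pX : 𝒳 → ℝ) (pW : 𝒲 → ℝ) : Prop :=
  (∀ x, pushf (fun a : s.A1 × s.A2 => s.p1 a.1 * s.p2 a.2) (fun a => s.f a.1 a.2) x = pX x)
    ∧ s.pw = pW

/-- Joint pmf on `(X₁, X₂, W, Y₁, Y₂)` induced by a split distribution and the channel. -/
def rsJoint {𝒳 𝒲 𝒴₁ 𝒴₂ : Type} [Fintype 𝒳] [Fintype 𝒲] (s : SplitDist2 𝒳 𝒲)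
    (ch : 𝒳 → 𝒲 → 𝒴₁ → 𝒴₂ → ℝ) : s.A1 × s.A2 × 𝒲 × 𝒴₁ × 𝒴₂ → ℝ :=
  fun ω => s.p1 ω.1 * s.p2 ω.2.1 * s.pw ω.2.2.1 *
    ch (s.f ω.1 ω.2.1) ω.2.2.1 ω.2.2.2.1 ω.2.2.2.2

/-- The rate-splitting region `𝓡_RS(p')`:
`R₁ ≤ I(X₁;Y₁) + I(X;Y₁|X₁,W)` and `R₂ ≤ I(W;Y₁|X₁)`. -/
def RRS {𝒳 𝒲 𝒴₁ 𝒴₂ : Type} [Fintype 𝒳] [Fintype 𝒲] [Fintype 𝒴₁] [Fintype 𝒴₂]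
    (s : SplitDist2 𝒳 𝒲) (ch : 𝒳 → 𝒲 → 𝒴₁ → 𝒴₂ → ℝ) : Set (ℝ × ℝ) :=
  {R | 0 ≤ R.1 ∧ 0 ≤ R.2 ∧
    R.1 ≤ miOf (rsJoint s ch) (fun ω => ω.1) (fun ω => ω.2.2.2.1)
          + cmiOf (rsJoint s ch) (fun ω => s.f ω.1 ω.2.1) (fun ω => ω.2.2.2.1)
              (fun ω => (ω.1, ω.2.2.1)) ∧
    R.2 ≤ cmiOf (rsJoint s ch) (fun ω => ω.2.2.1) (fun ω => ω.2.2.2.1) (fun ω => ω.1)}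

section Entropy

variable {Ω Ω' α β γ τ σ ξ : Type*} [Fintype Ω]

theorem ent_eq_sum_negMulLog [Fintype β] (p : β → ℝ) : ent p = ∑ b, Real.negMulLog (p b) := by
  simp [ent, Real.negMulLog]

theorem sum_pushf_mul [Fintype β] (q : Ω → ℝ) (f : Ω → β) (g : β → ℝ) :
    ∑ b, pushf q f b * g b = ∑ ω, q ω * g (f ω) := by
  simp only [pushf, Finset.sum_mul, ite_mul, zero_mul]
  rw [Finset.sum_comm]
  simp

theorem sum_pushf [Fintype β] (q : Ω → ℝ) (f : Ω → β) : ∑ b, pushf q f b = ∑ ω, q ω := by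
  simpa using sum_pushf_mul q f (fun _ => 1)

theorem pushf_nonneg {q : Ω → ℝ} (hq : ∀ ω, 0 ≤ q ω) (f : Ω → β) (b : β) : 0 ≤ pushf q f b :=
  Finset.sum_nonneg fun ω _ => by split_ifs <;> simp [hq]

theorem le_pushf {q : Ω → ℝ} (hq : ∀ ω, 0 ≤ q ω) (f : Ω → β) (ω : Ω) :
    q ω ≤ pushf q f (f ω) := by
  have := Finset.single_le_sum (f := fun ω' => if f ω' = f ω then q ω' else 0)
    (fun ω' _ => by split_ifs <;> simp [hq]) (Finset.mem_univ ω)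
  simpa [pushf] using this

theorem pushf_pushf [Fintype Ω'] (q : Ω → ℝ) (φ : Ω → Ω') (f : Ω' → β) :
    pushf (pushf q φ) f = pushf q (fun ω => f (φ ω)) := by
  ext b
  have := sum_pushf_mul q φ (fun ω' => if f ω' = b then 1 else 0)
  simpa [pushf] using this

theorem Hof_pushf [Fintype Ω'] [Fintype β] (q : Ω → ℝ) (φ : Ω → Ω') (f : Ω' → β) :
    Hof (pushf q φ) f = Hof q (fun ω => f (φ ω)) := by
  rw [Hof, Hof, pushf_pushf]

theorem pushf_apply_of_injective (q : Ω → ℝ) {φ : Ω → β} (hφ : Function.Injective φ) (ω : Ω) :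
    pushf q φ (φ ω) = q ω := by
  simp [pushf, hφ.eq_iff]

theorem Hof_eq_sum [Fintype α] (q : Ω → ℝ) (A : Ω → α) :
    Hof q A = -∑ ω, q ω * Real.log (pushf q A (A ω)) := by
  rw [Hof, ent, sum_pushf_mul q A (fun a => Real.log (pushf q A a))]

theorem Hof_congr [Fintype α] [Fintype β] (q : Ω → ℝ) (A : Ω → α) (B : Ω → β)
    (h : ∀ ω ω', A ω = A ω' ↔ B ω = B ω') : Hof q A = Hof q B := by
  simp only [Hof_eq_sum, pushf, h]

theorem sum_pushf_prod_left [Fintype α] (q : Ω → ℝ) (A : Ω → α) (B : Ω → β) (b : β) :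
    ∑ a, pushf q (fun ω => (A ω, B ω)) (a, b) = pushf q B b := by
  simp only [pushf, Prod.mk.injEq, ite_and]
  rw [Finset.sum_comm]
  simp

/-- Nonnegativity of conditional mutual information (strong subadditivity of entropy). -/
theorem cmiOf_nonneg [Fintype α] [Fintype β] [Fintype γ] {q : Ω → ℝ} (hq : ∀ ω, 0 ≤ q ω) (A : Ω → α) (B : Ω → β) (C : Ω → γ) :
    0 ≤ cmiOf q A B C := by
  set PAC := pushf q (fun ω => (A ω, C ω)) with hAC
  set PBC := pushf q (fun ω => (B ω, C ω)) with hBC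
  set PABC := pushf q (fun ω => (A ω, B ω, C ω)) with hABC
  set PC := pushf q C with hC
  let ratio : α × β × γ → ℝ := fun t =>
    PAC (t.1, t.2.2) * PBC (t.2.1, t.2.2) / (PABC t * PC t.2.2)
  have hnAC : ∀ t, 0 ≤ PAC t := pushf_nonneg hq _
  have hnBC : ∀ t, 0 ≤ PBC t := pushf_nonneg hq _
  have hnC : ∀ t, 0 ≤ PC t := pushf_nonneg hq _
  have hpoint : ∀ ω, q ω * (Real.log (PAC (A ω, C ω)) + Real.log (PBC (B ω, C ω))
      - Real.log (PABC (A ω, B ω, C ω)) - Real.log (PC (C ω)))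
      ≤ q ω * ratio (A ω, B ω, C ω) - q ω := by
    intro ω
    rcases (hq ω).eq_or_lt with h0 | h0
    · simp [← h0]
    have h1 : 0 < PAC (A ω, C ω) := h0.trans_le (le_pushf hq (fun ω => (A ω, C ω)) ω)
    have h2 : 0 < PBC (B ω, C ω) := h0.trans_le (le_pushf hq (fun ω => (B ω, C ω)) ω)
    have h3 : 0 < PABC (A ω, B ω, C ω) :=
      h0.trans_le (le_pushf hq (fun ω => (A ω, B ω, C ω)) ω)
    have h4 : 0 < PC (C ω) := h0.trans_le (le_pushf hq C ω)
    have hlog : Real.log (PAC (A ω, C ω)) + Real.log (PBC (B ω, C ω))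
        - Real.log (PABC (A ω, B ω, C ω)) - Real.log (PC (C ω))
        = Real.log (ratio (A ω, B ω, C ω)) := by
      simp only [ratio]
      rw [Real.log_div (by positivity) (by positivity), Real.log_mul h1.ne' h2.ne',
        Real.log_mul h3.ne' h4.ne']
      ring
    have hr : 0 < ratio (A ω, B ω, C ω) := by
      simp only [ratio]; positivity
    rw [hlog, ← mul_sub_one]
    exact mul_le_mul_of_nonneg_left (Real.log_le_sub_one_of_pos hr) h0.le
  have hratio : ∑ ω, q ω * ratio (A ω, B ω, C ω) ≤ ∑ ω, q ω := by
    rw [← sum_pushf_mul q (fun ω => (A ω, B ω, C ω)) ratio, ← sum_pushf q C, ← hABC, ← hC]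
    calc ∑ t, PABC t * ratio t
        ≤ ∑ t : α × β × γ, PAC (t.1, t.2.2) * PBC (t.2.1, t.2.2) / PC t.2.2 := by
          refine Finset.sum_le_sum fun t _ => ?_
          by_cases h : PABC t = 0
          · rw [h, zero_mul]
            exact div_nonneg (mul_nonneg (hnAC _) (hnBC _)) (hnC _)
          · simp only [ratio]
            rw [mul_div_assoc', mul_div_mul_left _ _ h]
      _ = ∑ c, (∑ a, PAC (a, c)) * (∑ b, PBC (b, c)) / PC c := by
          simp only [Fintype.sum_prod_type, Finset.sum_mul_sum, Finset.sum_div]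
          rw [Finset.sum_comm]
          simp only [Finset.sum_comm (s := (Finset.univ : Finset γ)) (t := (Finset.univ : Finset α))]
          rw [Finset.sum_comm]
          refine Finset.sum_congr rfl fun a _ => ?_
          rw [Finset.sum_comm]
      _ = ∑ c, PC c := by
          refine Finset.sum_congr rfl fun c _ => ?_
          rw [sum_pushf_prod_left, sum_pushf_prod_left, ← hC, mul_self_div_self]
  have hsum := Finset.sum_le_sum fun ω (_ : ω ∈ Finset.univ) => hpoint ω
  simp only [mul_sub, mul_add, Finset.sum_sub_distrib, Finset.sum_add_distrib] at hsum
  simp only [cmiOf, Hof_eq_sum, ← hAC, ← hBC, ← hABC, ← hC]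
  linarith

/-- Chain rule for `(S, h(B))` when `B` is generated from `T` by a kernel `k` that only sees
`g (S) = F (T)`. -/
theorem Hof_prod_of_kernel [Fintype β] [Fintype γ] [Fintype τ] [Fintype σ]
    (q : Ω → ℝ) (T : Ω → τ) (B : Ω → β) (u : τ → ℝ) (F : τ → ξ)
    (k : ξ → β → ℝ) (hq : ∀ t b, pushf q (fun ω => (T ω, B ω)) (t, b) = u t * k (F t) b)
    (hk : ∀ x, ∑ b, k x b = 1) (S : τ → σ) (g : σ → ξ) (hg : ∀ t, g (S t) = F t) (h : β → γ) :
    Hof q (fun ω => (S (T ω), h (B ω)))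
      = Hof q (fun ω => S (T ω)) + ∑ t, u t * ent (pushf (k (F t)) h) := by
  have hq' : pushf q (fun ω => (T ω, B ω)) = fun z => u z.1 * k (F z.1) z.2 :=
    funext fun z => hq z.1 z.2
  have hpair : ∀ s c, pushf q (fun ω => (S (T ω), h (B ω))) (s, c)
      = pushf u S s * pushf (k (g s)) h c := by
    intro s c
    rw [← pushf_pushf q (fun ω => (T ω, B ω)) (fun z => (S z.1, h z.2)), hq']
    simp only [pushf, Fintype.sum_prod_type, Finset.sum_mul_sum, Prod.mk.injEq]
    refine Finset.sum_congr rfl fun t _ => Finset.sum_congr rfl fun b _ => ?_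
    by_cases hs : S t = s
    · subst hs
      simp [hg]
    · simp [hs]
  have hS : pushf q (fun ω => S (T ω)) = pushf u S := by
    ext s
    rw [← pushf_pushf q (fun ω => (T ω, B ω)) (fun z => S z.1), hq']
    simp only [pushf, Fintype.sum_prod_type]
    refine Finset.sum_congr rfl fun t _ => ?_
    split_ifs
    · rw [← Finset.mul_sum, hk, mul_one]
    · simp
  rw [Hof, Hof, hS, ent_eq_sum_negMulLog, ent_eq_sum_negMulLog, Fintype.sum_prod_type]
  simp only [hpair, Real.negMulLog_mul, Finset.sum_add_distrib, ← Finset.sum_mul,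
    ← Finset.mul_sum, sum_pushf, hk, one_mul, ← ent_eq_sum_negMulLog]
  rw [sum_pushf_mul u S (fun s => ent (pushf (k (g s)) h))]
  simp only [hg]

end Entropy

section RateSplitting

variable {𝒳 𝒲 𝒴₁ 𝒴₂ : Type} [Fintype 𝒳] [Fintype 𝒲]

theorem miOf_prod_eq_add {Ω α β γ : Type*} [Fintype Ω] [Fintype α] [Fintype β] [Fintype γ]
    (q : Ω → ℝ) (A : Ω → α) (B : Ω → β) (C : Ω → γ) :
    miOf q (fun ω => (A ω, C ω)) B = miOf q C B + cmiOf q A B C := by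
  have h1 : Hof q (fun ω => ((A ω, C ω), B ω)) = Hof q (fun ω => (A ω, B ω, C ω)) :=
    Hof_congr _ _ _ fun _ _ => by simp only [Prod.mk.injEq]; tauto
  have h2 : Hof q (fun ω => (C ω, B ω)) = Hof q (fun ω => (B ω, C ω)) :=
    Hof_congr _ _ _ fun _ _ => by simp only [Prod.mk.injEq]; tauto
  simp only [miOf, cmiOf, h1, h2]
  ring

theorem rsJoint_nonneg (s : SplitDist2 𝒳 𝒲) {ch : 𝒳 → 𝒲 → 𝒴₁ → 𝒴₂ → ℝ}
    (hch0 : ∀ x w y₁ y₂, 0 ≤ ch x w y₁ y₂) (ω : s.A1 × s.A2 × 𝒲 × 𝒴₁ × 𝒴₂) :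
    0 ≤ rsJoint s ch ω :=
  mul_nonneg (mul_nonneg (mul_nonneg (s.p1_pmf.1 _) (s.p2_pmf.1 _)) (s.pw_pmf.1 _))
    (hch0 _ _ _ _)

variable [Fintype 𝒴₁] [Fintype 𝒴₂]

/-- Given `X`, the outputs are independent of `X₁`. -/
theorem Hof_rsJoint_markov {β : Type} [Fintype β] (s : SplitDist2 𝒳 𝒲)
    {ch : 𝒳 → 𝒲 → 𝒴₁ → 𝒴₂ → ℝ} (hch1 : ∀ x w, ∑ y₁, ∑ y₂, ch x w y₁ y₂ = 1)
    (h : 𝒲 × 𝒴₁ × 𝒴₂ → β) :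
    Hof (rsJoint s ch) (fun ω => ((ω.1, s.f ω.1 ω.2.1), h ω.2.2))
        + Hof (rsJoint s ch) (fun ω => s.f ω.1 ω.2.1)
      = Hof (rsJoint s ch) (fun ω => (ω.1, s.f ω.1 ω.2.1))
        + Hof (rsJoint s ch) (fun ω => (s.f ω.1 ω.2.1, h ω.2.2)) := by
  have hinj : Function.Injective
      (fun ω : s.A1 × s.A2 × 𝒲 × 𝒴₁ × 𝒴₂ => ((ω.1, ω.2.1), ω.2.2)) := by
    rintro ⟨a, b, c⟩ ⟨a', b', c'⟩ h
    simpa [and_assoc] using h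
  have key := fun {σ : Type} [Fintype σ] => Hof_prod_of_kernel (σ := σ) (γ := β) (rsJoint s ch)
    (fun ω => (ω.1, ω.2.1)) (fun ω => ω.2.2) (fun t => s.p1 t.1 * s.p2 t.2)
    (fun t => s.f t.1 t.2) (fun x b => s.pw b.1 * ch x b.1 b.2.1 b.2.2)
    (fun t b => (pushf_apply_of_injective (rsJoint s ch) hinj (t.1, t.2, b)).trans
      (mul_assoc _ _ _))
    (fun x => by
      simp only [Fintype.sum_prod_type, ← Finset.mul_sum, hch1, mul_one, s.pw_pmf.2])
  have h1 := key (fun t => (t.1, s.f t.1 t.2)) (fun z => z.2) (fun _ => rfl) h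
  have h2 := key (fun t => s.f t.1 t.2) id (fun _ => rfl) h
  linarith

/-- `W` is independent of every function of `(X₁, X₂)`. -/
theorem Hof_rsJoint_indep {σ : Type} [Fintype σ] (s : SplitDist2 𝒳 𝒲)
    {ch : 𝒳 → 𝒲 → 𝒴₁ → 𝒴₂ → ℝ} (hch1 : ∀ x w, ∑ y₁, ∑ y₂, ch x w y₁ y₂ = 1)
    (S : s.A1 × s.A2 → σ) :
    Hof (rsJoint s ch) (fun ω => (ω.2.2.1, S (ω.1, ω.2.1)))
      = Hof (rsJoint s ch) (fun ω => ω.2.2.1)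
        + Hof (rsJoint s ch) (fun ω => S (ω.1, ω.2.1)) := by
  have key := fun {σ : Type} [Fintype σ] => Hof_prod_of_kernel (σ := σ) (γ := 𝒲) (rsJoint s ch)
    (fun ω => (ω.1, ω.2.1)) (fun ω => ω.2.2.1) (fun t => s.p1 t.1 * s.p2 t.2)
    (fun _ => ()) (fun _ => s.pw)
    (by
      rintro ⟨a, a'⟩ b
      simp only [pushf, rsJoint, Fintype.sum_prod_type, Prod.mk.injEq, ite_and,
        Finset.sum_ite_irrel, Finset.sum_const_zero, ← Finset.mul_sum, hch1]
      simp)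
    (fun _ => s.pw_pmf.2)
  have h1 := key S (fun _ => ()) (fun _ => rfl) id
  have h2 := key (fun _ => ()) id (fun _ => rfl) id
  have h3 : Hof (rsJoint s ch) (fun _ => ()) = 0 := by
    have : ∑ ω, rsJoint s ch ω = 1 := by
      simp only [rsJoint, Fintype.sum_prod_type, ← Finset.mul_sum, hch1, mul_one, s.pw_pmf.2,
        s.p2_pmf.2, s.p1_pmf.2]
    simp [Hof, ent, pushf, this]
  have h4 : Hof (rsJoint s ch) (fun ω => ((), ω.2.2.1))
      = Hof (rsJoint s ch) (fun ω => ω.2.2.1) := Hof_congr _ _ _ fun _ _ => by simp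
  have h5 : Hof (rsJoint s ch) (fun ω => (ω.2.2.1, S (ω.1, ω.2.1)))
      = Hof (rsJoint s ch) (fun ω => (S (ω.1, ω.2.1), ω.2.2.1)) :=
    Hof_congr _ _ _ fun _ _ => by simp only [Prod.mk.injEq]; tauto
  simp only [id] at h1 h2
  linarith

/-- The sum of the two rate bounds equals `I(X, W; Y₁)` for every split. -/
theorem rsJoint_sum_rate (s : SplitDist2 𝒳 𝒲) {ch : 𝒳 → 𝒲 → 𝒴₁ → 𝒴₂ → ℝ}
    (hch1 : ∀ x w, ∑ y₁, ∑ y₂, ch x w y₁ y₂ = 1) :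
    miOf (rsJoint s ch) (fun ω => ω.1) (fun ω => ω.2.2.2.1)
        + cmiOf (rsJoint s ch) (fun ω => s.f ω.1 ω.2.1) (fun ω => ω.2.2.2.1)
            (fun ω => (ω.1, ω.2.2.1))
        + cmiOf (rsJoint s ch) (fun ω => ω.2.2.1) (fun ω => ω.2.2.2.1) (fun ω => ω.1)
      = miOf (rsJoint s ch) (fun ω => (s.f ω.1 ω.2.1, ω.2.2.1)) (fun ω => ω.2.2.2.1) := by
  set q := rsJoint s ch
  have m1 := Hof_rsJoint_markov s hch1 (fun b => b.1)
  have m2 := Hof_rsJoint_markov s hch1 (fun b => (b.1, b.2.1))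
  have e1 : Hof q (fun ω => ((ω.1, s.f ω.1 ω.2.1), ω.2.2.1))
      = Hof q (fun ω => (s.f ω.1 ω.2.1, ω.1, ω.2.2.1)) :=
    Hof_congr _ _ _ fun _ _ => by simp only [Prod.mk.injEq]; tauto
  have e2 : Hof q (fun ω => ((ω.1, s.f ω.1 ω.2.1), ω.2.2.1, ω.2.2.2.1))
      = Hof q (fun ω => (s.f ω.1 ω.2.1, ω.2.2.2.1, ω.1, ω.2.2.1)) :=
    Hof_congr _ _ _ fun _ _ => by simp only [Prod.mk.injEq]; tauto
  have e3 : Hof q (fun ω => (s.f ω.1 ω.2.1, ω.2.2.1, ω.2.2.2.1))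
      = Hof q (fun ω => ((s.f ω.1 ω.2.1, ω.2.2.1), ω.2.2.2.1)) :=
    Hof_congr _ _ _ fun _ _ => by simp only [Prod.mk.injEq]; tauto
  have e4 : Hof q (fun ω => (ω.2.2.2.1, ω.1, ω.2.2.1))
      = Hof q (fun ω => (ω.2.2.1, ω.2.2.2.1, ω.1)) :=
    Hof_congr _ _ _ fun _ _ => by simp only [Prod.mk.injEq]; tauto
  have e5 : Hof q (fun ω => (ω.2.2.2.1, ω.1)) = Hof q (fun ω => (ω.1, ω.2.2.2.1)) :=
    Hof_congr _ _ _ fun _ _ => by simp only [Prod.mk.injEq]; tauto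
  have e6 : Hof q (fun ω => (ω.2.2.1, ω.1)) = Hof q (fun ω => (ω.1, ω.2.2.1)) :=
    Hof_congr _ _ _ fun _ _ => by simp only [Prod.mk.injEq]; tauto
  simp only [miOf, cmiOf]
  linarith

theorem rsJoint_miOf_le_cmiOf (s : SplitDist2 𝒳 𝒲) {ch : 𝒳 → 𝒲 → 𝒴₁ → 𝒴₂ → ℝ}
    (hch0 : ∀ x w y₁ y₂, 0 ≤ ch x w y₁ y₂) (hch1 : ∀ x w, ∑ y₁, ∑ y₂, ch x w y₁ y₂ = 1) :
    miOf (rsJoint s ch) (fun ω => ω.2.2.1) (fun ω => ω.2.2.2.1)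
      ≤ cmiOf (rsJoint s ch) (fun ω => ω.2.2.1) (fun ω => ω.2.2.2.1) (fun ω => ω.1) := by
  set q := rsJoint s ch
  have i1 := Hof_rsJoint_indep s hch1 (fun t => t.1)
  have n := cmiOf_nonneg (rsJoint_nonneg s hch0) (fun ω => ω.2.2.1) (fun ω => ω.1)
    (fun ω => ω.2.2.2.1)
  have e1 : Hof q (fun ω => (ω.2.2.1, ω.1, ω.2.2.2.1))
      = Hof q (fun ω => (ω.2.2.1, ω.2.2.2.1, ω.1)) :=
    Hof_congr _ _ _ fun _ _ => by simp only [Prod.mk.injEq]; tauto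
  have e2 : Hof q (fun ω => (ω.2.2.2.1, ω.1)) = Hof q (fun ω => (ω.1, ω.2.2.2.1)) :=
    Hof_congr _ _ _ fun _ _ => by simp only [Prod.mk.injEq]; tauto
  simp only [miOf, cmiOf] at n ⊢
  linarith

theorem rsJoint_cmiOf_le_cmiOf (s : SplitDist2 𝒳 𝒲) {ch : 𝒳 → 𝒲 → 𝒴₁ → 𝒴₂ → ℝ}
    (hch0 : ∀ x w y₁ y₂, 0 ≤ ch x w y₁ y₂) (hch1 : ∀ x w, ∑ y₁, ∑ y₂, ch x w y₁ y₂ = 1) :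
    cmiOf (rsJoint s ch) (fun ω => ω.2.2.1) (fun ω => ω.2.2.2.1) (fun ω => ω.1)
      ≤ cmiOf (rsJoint s ch) (fun ω => ω.2.2.1) (fun ω => ω.2.2.2.1)
          (fun ω => s.f ω.1 ω.2.1) := by
  set q := rsJoint s ch
  have i1 := Hof_rsJoint_indep s hch1 (fun t => t.1)
  have i2 := Hof_rsJoint_indep s hch1 (fun t => s.f t.1 t.2)
  have m1 := Hof_rsJoint_markov s hch1 (fun b => b.2.1)
  have m2 := Hof_rsJoint_markov s hch1 (fun b => (b.1, b.2.1))
  have n := cmiOf_nonneg (rsJoint_nonneg s hch0) (fun ω => s.f ω.1 ω.2.1) (fun ω => ω.2.2.1)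
    (fun ω => (ω.2.2.2.1, ω.1))
  have e1 : Hof q (fun ω => ((ω.1, s.f ω.1 ω.2.1), ω.2.2.2.1))
      = Hof q (fun ω => (s.f ω.1 ω.2.1, ω.2.2.2.1, ω.1)) :=
    Hof_congr _ _ _ fun _ _ => by simp only [Prod.mk.injEq]; tauto
  have e2 : Hof q (fun ω => ((ω.1, s.f ω.1 ω.2.1), ω.2.2.1, ω.2.2.2.1))
      = Hof q (fun ω => (s.f ω.1 ω.2.1, ω.2.2.1, ω.2.2.2.1, ω.1)) :=
    Hof_congr _ _ _ fun _ _ => by simp only [Prod.mk.injEq]; tauto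
  have e3 : Hof q (fun ω => (s.f ω.1 ω.2.1, ω.2.2.1, ω.2.2.2.1))
      = Hof q (fun ω => (ω.2.2.1, ω.2.2.2.1, s.f ω.1 ω.2.1)) :=
    Hof_congr _ _ _ fun _ _ => by simp only [Prod.mk.injEq]; tauto
  have e4 : Hof q (fun ω => (s.f ω.1 ω.2.1, ω.2.2.2.1))
      = Hof q (fun ω => (ω.2.2.2.1, s.f ω.1 ω.2.1)) :=
    Hof_congr _ _ _ fun _ _ => by simp only [Prod.mk.injEq]; tauto
  simp only [cmiOf] at n ⊢
  linarith

/-- Under a matching split, `(X, W, Y₁, Y₂)` has the law induced by the original input pmf. -/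
theorem pushf_rsJoint (s : SplitDist2 𝒳 𝒲) {pX : 𝒳 → ℝ} {pW : 𝒲 → ℝ} (hs : s.Matches pX pW)
    (ch : 𝒳 → 𝒲 → 𝒴₁ → 𝒴₂ → ℝ) :
    pushf (rsJoint s ch) (fun ω => (s.f ω.1 ω.2.1, ω.2.2)) = icJoint pX pW ch := by
  ext ⟨x, b⟩
  obtain ⟨hX, rfl⟩ := hs
  simp only [icJoint, ← hX, pushf, rsJoint, Fintype.sum_prod_type (α₁ := s.A1),
    Fintype.sum_prod_type (α₁ := s.A2), Finset.sum_mul, Prod.mk.injEq]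
  refine Finset.sum_congr rfl fun a _ => Finset.sum_congr rfl fun a' _ => ?_
  by_cases h : s.f a a' = x
  · simp [h]
  · simp [h]

theorem Hof_icJoint {β : Type} [Fintype β] (s : SplitDist2 𝒳 𝒲) {pX : 𝒳 → ℝ} {pW : 𝒲 → ℝ}
    (hs : s.Matches pX pW) (ch : 𝒳 → 𝒲 → 𝒴₁ → 𝒴₂ → ℝ) (A : 𝒳 × 𝒲 × 𝒴₁ × 𝒴₂ → β) :
    Hof (icJoint pX pW ch) A = Hof (rsJoint s ch) (fun ω => A (s.f ω.1 ω.2.1, ω.2.2)) := by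
  rw [← pushf_rsJoint s hs ch, Hof_pushf]

/-- With probability `1 - t` the first layer is silent and `X = X₂`; otherwise `X = X₁`. -/
def erasureSplit {pX : 𝒳 → ℝ} {pW : 𝒲 → ℝ} (hpX : IsPMF pX) (hpW : IsPMF pW)
    {t : ℝ} (ht0 : 0 ≤ t) (ht1 : t ≤ 1) : SplitDist2 𝒳 𝒲 where
  A1 := Option 𝒳
  A2 := 𝒳
  p1 := fun o => o.elim (1 - t) (fun x => t * pX x)
  p2 := pX
  pw := pW
  f := fun o x => o.getD x
  p1_pmf := by
    refine ⟨?_, ?_⟩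
    · rintro (_ | x)
      · simpa using ht1
      · exact mul_nonneg ht0 (hpX.1 x)
    · simp [Fintype.sum_option, ← Finset.mul_sum, hpX.2]
  p2_pmf := hpX
  pw_pmf := hpW

theorem erasureSplit_matches {pX : 𝒳 → ℝ} {pW : 𝒲 → ℝ} (hpX : IsPMF pX) (hpW : IsPMF pW)
    {t : ℝ} (ht0 : 0 ≤ t) (ht1 : t ≤ 1) : (erasureSplit hpX hpW ht0 ht1).Matches pX pW := by
  refine ⟨fun x => ?_, rfl⟩
  change pushf (fun a : Option 𝒳 × 𝒳 => a.1.elim (1 - t) (fun x => t * pX x) * pX a.2)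
    (fun a => a.1.getD a.2) x = pX x
  simp only [pushf, Fintype.sum_prod_type, Fintype.sum_option, Option.getD_none,
    Option.getD_some, Option.elim, Finset.sum_ite_irrel, Finset.sum_const_zero,
    ← Finset.mul_sum, hpX.2]
  simp
  ring

theorem Hof_erasureSplit {β : Type} [Fintype β] {pX : 𝒳 → ℝ} {pW : 𝒲 → ℝ} (hpX : IsPMF pX)
    (hpW : IsPMF pW) {t : ℝ} (ht0 : 0 ≤ t) (ht1 : t ≤ 1) {ch : 𝒳 → 𝒲 → 𝒴₁ → 𝒴₂ → ℝ}
    (hch1 : ∀ x w, ∑ y₁, ∑ y₂, ch x w y₁ y₂ = 1) (h : 𝒲 × 𝒴₁ × 𝒴₂ → β) :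
    Hof (rsJoint (erasureSplit hpX hpW ht0 ht1) ch) (fun ω => (ω.1, h ω.2.2))
      = (1 - t) * Hof (icJoint pX pW ch) (fun ω => h ω.2)
        + t * Hof (icJoint pX pW ch) (fun ω => (ω.1, h ω.2))
        + (Real.negMulLog (1 - t) + Real.negMulLog t) := by
  have hmass : ∑ ω, icJoint pX pW ch ω = 1 := by
    simp only [icJoint, Fintype.sum_prod_type, ← Finset.mul_sum, hch1, mul_one, hpW.2, hpX.2]
  set P : Option 𝒳 × β → ℝ :=
    pushf (rsJoint (erasureSplit hpX hpW ht0 ht1) ch) (fun ω => (ω.1, h ω.2.2))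
  have hP' : P = pushf (fun ω : Option 𝒳 × 𝒳 × 𝒲 × 𝒴₁ × 𝒴₂ =>
      ω.1.elim (1 - t) (fun x => t * pX x) * pX ω.2.1 * pW ω.2.2.1 *
        ch (ω.1.getD ω.2.1) ω.2.2.1 ω.2.2.2.1 ω.2.2.2.2) (fun ω => (ω.1, h ω.2.2)) := rfl
  have hnone : ∀ b, P (none, b) = (1 - t) * pushf (icJoint pX pW ch) (fun ω => h ω.2) b := by
    intro b
    rw [hP', pushf, Fintype.sum_prod_type, Fintype.sum_option]
    simp [pushf, icJoint, Finset.mul_sum, mul_assoc]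
  have hsome : ∀ x b, P (some x, b)
      = t * pushf (icJoint pX pW ch) (fun ω => (ω.1, h ω.2)) (x, b) := by
    intro x b
    rw [hP', pushf, Fintype.sum_prod_type, Fintype.sum_option]
    have hterm : ∀ (x₁ x₂ : 𝒳) (c : 𝒲 × 𝒴₁ × 𝒴₂), (if x₁ = x then if h c = b then
        t * pX x₁ * pX x₂ * pW c.1 * ch x₁ c.1 c.2.1 c.2.2 else 0 else 0)
        = pX x₂ * (t * if x₁ = x then if h c = b then
          pX x₁ * pW c.1 * ch x₁ c.1 c.2.1 c.2.2 else 0 else 0) := by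
      intro x₁ x₂ c
      split_ifs <;> ring
    simp only [Prod.mk.injEq, reduceCtorEq, false_and, if_false, Finset.sum_const_zero, zero_add,
      Option.some.injEq, Option.elim, Option.getD_some, Fintype.sum_prod_type (α₁ := 𝒳), ite_and,
      pushf, icJoint, Finset.mul_sum, hterm]
    refine Finset.sum_congr rfl fun x₁ _ => ?_
    simp only [← Finset.mul_sum, ← Finset.sum_mul, hpX.2, one_mul]
  change ent P = _
  rw [ent_eq_sum_negMulLog, Fintype.sum_prod_type, Fintype.sum_option]
  simp only [hnone, hsome, Real.negMulLog_mul, Finset.sum_add_distrib, ← Finset.sum_mul,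
    ← Finset.mul_sum, ← Fintype.sum_prod_type', Prod.mk.eta, sum_pushf, hmass, Hof,
    ent_eq_sum_negMulLog]
  ring

/-- Under the erasure split, `I(W; Y₁ | X₁)` interpolates linearly between `I(W; Y₁)` and
`I(W; Y₁ | X)`. -/
theorem cmiOf_erasureSplit {pX : 𝒳 → ℝ} {pW : 𝒲 → ℝ} (hpX : IsPMF pX)
    (hpW : IsPMF pW) {t : ℝ} (ht0 : 0 ≤ t) (ht1 : t ≤ 1) {ch : 𝒳 → 𝒲 → 𝒴₁ → 𝒴₂ → ℝ}
    (hch1 : ∀ x w, ∑ y₁, ∑ y₂, ch x w y₁ y₂ = 1) :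
    cmiOf (rsJoint (erasureSplit hpX hpW ht0 ht1) ch) (fun ω => ω.2.2.1) (fun ω => ω.2.2.2.1)
        (fun ω => ω.1)
      = (1 - t) * miOf (icJoint pX pW ch) (fun ω => ω.2.1) (fun ω => ω.2.2.1)
        + t * cmiOf (icJoint pX pW ch) (fun ω => ω.2.1) (fun ω => ω.2.2.1) (fun ω => ω.1) := by
  have key := fun {β : Type} [Fintype β] => Hof_erasureSplit (β := β) hpX hpW ht0 ht1 hch1
  have k1 := key (fun b => b.1)
  have k2 := key (fun b => b.2.1)
  have k3 := key (fun b => (b.1, b.2.1))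
  have k4 := key (fun _ => ())
  set q := rsJoint (erasureSplit hpX hpW ht0 ht1) ch
  set r := icJoint pX pW ch with hr
  have z : Hof r (fun _ => ()) = 0 := by
    have : ∑ ω, r ω = 1 := by
      simp only [hr, icJoint, Fintype.sum_prod_type, ← Finset.mul_sum, hch1, mul_one, hpW.2,
        hpX.2]
    simp [Hof, ent, pushf, this]
  have e1 : Hof q (fun ω => (ω.1, ω.2.2.1)) = Hof q (fun ω => (ω.2.2.1, ω.1)) :=
    Hof_congr _ _ _ fun _ _ => by simp only [Prod.mk.injEq]; tauto
  have e2 : Hof q (fun ω => (ω.1, ω.2.2.2.1)) = Hof q (fun ω => (ω.2.2.2.1, ω.1)) :=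
    Hof_congr _ _ _ fun _ _ => by simp only [Prod.mk.injEq]; tauto
  have e3 : Hof q (fun ω => (ω.1, ω.2.2.1, ω.2.2.2.1))
      = Hof q (fun ω => (ω.2.2.1, ω.2.2.2.1, ω.1)) :=
    Hof_congr _ _ _ fun _ _ => by simp only [Prod.mk.injEq]; tauto
  have e4 : Hof q (fun ω => (ω.1, ())) = Hof q (fun ω => ω.1) :=
    Hof_congr _ _ _ fun _ _ => by simp
  have f1 : Hof r (fun ω => (ω.1, ω.2.1)) = Hof r (fun ω => (ω.2.1, ω.1)) :=
    Hof_congr _ _ _ fun _ _ => by simp only [Prod.mk.injEq]; tauto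
  have f2 : Hof r (fun ω => (ω.1, ω.2.2.1)) = Hof r (fun ω => (ω.2.2.1, ω.1)) :=
    Hof_congr _ _ _ fun _ _ => by simp only [Prod.mk.injEq]; tauto
  have f3 : Hof r (fun ω => (ω.1, ω.2.1, ω.2.2.1))
      = Hof r (fun ω => (ω.2.1, ω.2.2.1, ω.1)) :=
    Hof_congr _ _ _ fun _ _ => by simp only [Prod.mk.injEq]; tauto
  have f4 : Hof r (fun ω => (ω.1, ())) = Hof r (fun ω => ω.1) :=
    Hof_congr _ _ _ fun _ _ => by simp
  rw [e1, f1] at k1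
  rw [e2, f2] at k2
  rw [e3, f3] at k3
  rw [e4, f4, z] at k4
  simp only [miOf, cmiOf, k1, k2, k3, k4]
  ring

theorem erasureSplit_mem_RRS {pX : 𝒳 → ℝ} {pW : 𝒲 → ℝ} (hpX : IsPMF pX) (hpW : IsPMF pW)
    {ch : 𝒳 → 𝒲 → 𝒴₁ → 𝒴₂ → ℝ} (hch1 : ∀ x w, ∑ y₁, ∑ y₂, ch x w y₁ y₂ = 1)
    {R : ℝ × ℝ} (hR : R ∈ R1SD pX pW ch) :
    ∃ (t : ℝ) (ht0 : 0 ≤ t) (ht1 : t ≤ 1), R ∈ RRS (erasureSplit hpX hpW ht0 ht1) ch := by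
  obtain ⟨h1, h2, hR1, hR2, hR12⟩ := hR
  have hsum : ∀ {t : ℝ} (ht0 : 0 ≤ t) (ht1 : t ≤ 1), _ := fun ht0 ht1 =>
    rsJoint_sum_rate (erasureSplit hpX hpW ht0 ht1) hch1
  have hmi : ∀ {t : ℝ} (ht0 : 0 ≤ t) (ht1 : t ≤ 1),
      miOf (icJoint pX pW ch) (fun ω => (ω.1, ω.2.1)) (fun ω => ω.2.2.1)
      = miOf (rsJoint (erasureSplit hpX hpW ht0 ht1) ch)
        (fun ω => ((erasureSplit hpX hpW ht0 ht1).f ω.1 ω.2.1, ω.2.2.1))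
        (fun ω => ω.2.2.2.1) := fun ht0 ht1 => by
    simp only [miOf, Hof_icJoint _ (erasureSplit_matches hpX hpW ht0 ht1)]
  have hchain := miOf_prod_eq_add (icJoint pX pW ch) (fun ω => ω.1) (fun ω => ω.2.2.1)
    (fun ω => ω.2.1)
  set a := miOf (icJoint pX pW ch) (fun ω => ω.2.1) (fun ω => ω.2.2.1)
  set b := cmiOf (icJoint pX pW ch) (fun ω => ω.2.1) (fun ω => ω.2.2.1) (fun ω => ω.1)
  rcases le_or_gt R.2 a with hle | hlt
  · refine ⟨0, le_rfl, zero_le_one, h1, h2, ?_, ?_⟩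
    · have hc := cmiOf_erasureSplit hpX hpW le_rfl zero_le_one hch1
      have := hsum le_rfl zero_le_one
      have := hmi le_rfl zero_le_one
      linarith
    · rw [cmiOf_erasureSplit]
      · linarith
      · exact hch1
  · have hab : 0 < b - a := by linarith
    have ht0 : 0 ≤ (R.2 - a) / (b - a) := div_nonneg (by linarith) hab.le
    have ht1 : (R.2 - a) / (b - a) ≤ 1 := (div_le_one hab).2 (by linarith)
    have hc := cmiOf_erasureSplit hpX hpW ht0 ht1 hch1
    have hR2eq : (1 - (R.2 - a) / (b - a)) * a + (R.2 - a) / (b - a) * b = R.2 := by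
      field_simp
      ring
    refine ⟨_, ht0, ht1, h1, h2, ?_, ?_⟩
    · have := hsum ht0 ht1
      have := hmi ht0 ht1
      linarith
    · linarith

theorem RRS_subset_R1SD (s : SplitDist2 𝒳 𝒲) {pX : 𝒳 → ℝ} {pW : 𝒲 → ℝ} (hs : s.Matches pX pW)
    {ch : 𝒳 → 𝒲 → 𝒴₁ → 𝒴₂ → ℝ} (hch0 : ∀ x w y₁ y₂, 0 ≤ ch x w y₁ y₂)
    (hch1 : ∀ x w, ∑ y₁, ∑ y₂, ch x w y₁ y₂ = 1) : RRS s ch ⊆ R1SD pX pW ch := by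
  rintro R ⟨h1, h2, hR1, hR2⟩
  have hsum := rsJoint_sum_rate s hch1
  have hle := rsJoint_miOf_le_cmiOf s hch0 hch1
  have hle' := rsJoint_cmiOf_le_cmiOf s hch0 hch1
  have hchain := miOf_prod_eq_add (rsJoint s ch) (fun ω => s.f ω.1 ω.2.1)
    (fun ω => ω.2.2.2.1) (fun ω => ω.2.2.1)
  refine ⟨h1, h2, ?_, ?_, ?_⟩
  · have : cmiOf (icJoint pX pW ch) (fun ω => ω.1) (fun ω => ω.2.2.1) (fun ω => ω.2.1)
        = cmiOf (rsJoint s ch) (fun ω => s.f ω.1 ω.2.1) (fun ω => ω.2.2.2.1)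
          (fun ω => ω.2.2.1) := by
      simp only [cmiOf, Hof_icJoint s hs]
    linarith
  · have : cmiOf (icJoint pX pW ch) (fun ω => ω.2.1) (fun ω => ω.2.2.1) (fun ω => ω.1)
        = cmiOf (rsJoint s ch) (fun ω => ω.2.2.1) (fun ω => ω.2.2.2.1)
          (fun ω => s.f ω.1 ω.2.1) := by
      simp only [cmiOf, Hof_icJoint s hs]
    linarith
  · have : miOf (icJoint pX pW ch) (fun ω => (ω.1, ω.2.1)) (fun ω => ω.2.2.1)
        = miOf (rsJoint s ch) (fun ω => (s.f ω.1 ω.2.1, ω.2.2.1)) (fun ω => ω.2.2.2.1) := by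
      simp only [miOf, Hof_icJoint s hs]
    linarith

end RateSplitting

/-- Layer-splitting lemma: `𝓡₁,SD(p) = ⋃_{p' ≃ p} 𝓡_RS(p')`. -/
theorem layer_splitting_lemma {𝒳 𝒲 𝒴₁ 𝒴₂ : Type}
    [Fintype 𝒳] [Fintype 𝒲] [Fintype 𝒴₁] [Fintype 𝒴₂]
    (pX : 𝒳 → ℝ) (pW : 𝒲 → ℝ) (ch : 𝒳 → 𝒲 → 𝒴₁ → 𝒴₂ → ℝ)
    (hpX : IsPMF pX) (hpW : IsPMF pW)
    (hch0 : ∀ x w y₁ y₂, 0 ≤ ch x w y₁ y₂)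
    (hch1 : ∀ x w, ∑ y₁, ∑ y₂, ch x w y₁ y₂ = 1) :
    R1SD pX pW ch = ⋃ (s : SplitDist2 𝒳 𝒲) (_ : s.Matches pX pW), RRS s ch := by

  ext R
  simp only [Set.mem_iUnion]
  refine ⟨fun hR => ?_, fun ⟨s, hs, hR⟩ => RRS_subset_R1SD s hs hch0 hch1 hR⟩
  obtain ⟨t, ht0, ht1, hmem⟩ := erasureSplit_mem_RRS hpX hpW hch1 hR
  exact ⟨_, erasureSplit_matches hpX hpW ht0 ht1, hmem⟩
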